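/- Let c ≥ 3 be an odd natural number and let d ≥ 2. Then the inequality disc(Δ^d H, c) ≤ disc(H, c) holds for all hypergraphs H if and only if the inequality disc(Δ^d H, 2c) ≤ disc(H, 2c) holds for all hypergraphs H. -/

import Mathlib

/-- The Stirling numbers of the second kind: `stirling2 d k` is the number of
partitions of a `d`-element set into `k` nonempty parts. -/
def stirling2 : ℕ → ℕ → ℕ
  | 0, 0 => 1
  | 0, _ + 1 => 0
  | _ + 1, 0 => 0
  | d + 1, k + 1 => (k + 1) * stirling2 d (k + 1) + stirling2 d k

/-- The discrepancy of a `c`-coloring `χ` of the hypergraph with edge set `H`. -/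
noncomputable def discCol {V : Type} (H : Finset (Finset V)) (c : ℕ) (χ : V → Fin c) : ℝ :=
  ⨆ E ∈ H, ⨆ i : Fin c, |((E.filter fun v => χ v = i).card : ℝ) - (E.card : ℝ) / (c : ℝ)|

/-- The `c`-color discrepancy of the hypergraph with edge set `H`. -/
noncomputable def disc {V : Type} (H : Finset (Finset V)) (c : ℕ) : ℝ :=
  ⨅ χ : V → Fin c, discCol H c χ

/-- The `d`-fold symmetric product of a hypergraph: edge set `{E^d : E ∈ H}`
on the vertex set `V^d`. -/
def symProd {V : Type} [DecidableEq V] (H : Finset (Finset V)) (d : ℕ) :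
    Finset (Finset (Fin d → V)) :=
  H.image fun E => Fintype.piFinset fun _ : Fin d => E

/-- Ramsey's theorem for `k`-element subsets. -/
theorem exists_homogeneous_of_card_eq (K : Type) [Finite K] (k m : ℕ) :
    ∃ N : ℕ, ∀ (V : Type) [LinearOrder V] (A : Finset V) (g : Finset V → K), N ≤ A.card →
      ∃ T ⊆ A, T.card = m ∧ ∃ col : K, ∀ S ⊆ T, S.card = k → g S = col := by
  induction k generalizing m with
  | zero =>
    refine ⟨m, fun V _ A g hA => ?_⟩
    obtain ⟨T, hTA, hT⟩ := Finset.exists_subset_card_eq hA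
    refine ⟨T, hTA, hT, g ∅, fun S _ hS => ?_⟩
    rw [Finset.card_eq_zero.1 hS]
  | succ k ih =>
    classical
    have := Fintype.ofFinite K
    have pre : ∀ l : ℕ, ∃ N : ℕ, ∀ (V : Type) [LinearOrder V] (A : Finset V)
        (g : Finset V → K), N ≤ A.card → ∃ B ⊆ A, B.card = l ∧ ∃ h : V → K,
          ∀ a, ∀ S ⊆ B, a ∈ B → (∀ x ∈ S, a < x) → S.card = k → g (insert a S) = h a := by
      intro l
      induction l with
      | zero =>
        refine ⟨0, fun V _ A g _ => ⟨∅, by simp, by simp, fun _ => g ∅, ?_⟩⟩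
        simp
      | succ l ihl =>
        obtain ⟨N, hN⟩ := ihl
        obtain ⟨M, hM⟩ := ih N
        refine ⟨M + 1, fun V _ A g hA => ?_⟩
        have hne : A.Nonempty := Finset.card_pos.1 (by omega)
        set a := A.min' hne with ha
        have haA : a ∈ A := A.min'_mem hne
        obtain ⟨T, hTA, hT, col, hcol⟩ := hM V (A.erase a) (fun S => g (insert a S))
          (by rw [Finset.card_erase_of_mem haA]; omega)
        obtain ⟨B, hBT, hB, h, hh⟩ := hN V T g hT.ge
        have hlt : ∀ x ∈ B, a < x := fun x hx =>
          A.min'_lt_of_mem_erase_min' hne (hTA (hBT hx))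
        have haB : a ∉ B := fun h => lt_irrefl _ (hlt a h)
        refine ⟨insert a B, ?_, by rw [Finset.card_insert_of_notMem haB, hB],
          Function.update h a col, ?_⟩
        · exact Finset.insert_subset haA
            ((hBT.trans hTA).trans (Finset.erase_subset _ _))
        · intro b S hS hb hbS hcard
          have hab : a ≤ b := by
            rcases Finset.mem_insert.1 hb with rfl | hb
            · exact le_rfl
            · exact (hlt b hb).le
          have hSB : S ⊆ B := fun x hx => by
            rcases Finset.mem_insert.1 (hS hx) with h1 | h1
            · exact absurd (hbS x hx) (by rw [h1]; exact not_lt.2 hab)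
            · exact h1
          rcases Finset.mem_insert.1 hb with rfl | hb
          · rw [Function.update_self]
            exact hcol S (hSB.trans hBT) hcard
          · rw [Function.update_of_ne (hlt b hb).ne']
            exact hh b S hSB hb hbS hcard
    obtain ⟨N, hN⟩ := pre (Fintype.card K * m)
    refine ⟨N, fun V _ A g hA => ?_⟩
    obtain ⟨B, hBA, hB, h, hh⟩ := hN V A g hA
    have : Nonempty K := ⟨g ∅⟩
    obtain ⟨col, -, hc⟩ := Finset.exists_le_card_fiber_of_mul_le_card_of_maps_to
      (s := B) (t := Finset.univ) (f := h) (n := m) (by simp) Finset.univ_nonempty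
      (by rw [hB, Finset.card_univ])
    obtain ⟨T, hT, hTm⟩ := Finset.exists_subset_card_eq hc
    have hTB : T ⊆ B := hT.trans (Finset.filter_subset _ _)
    refine ⟨T, hTB.trans hBA, hTm, col, fun S hS hcard => ?_⟩
    have hne : S.Nonempty := Finset.card_pos.1 (by omega)
    have hmem := S.min'_mem hne
    rw [← Finset.insert_erase hmem, hh _ (S.erase (S.min' hne))
      ((Finset.erase_subset _ _).trans (hS.trans hTB)) (hTB (hS hmem))
      (fun x hx => S.min'_lt_of_mem_erase_min' hne hx)
      (by rw [Finset.card_erase_of_mem hmem]; omega)]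
    exact (Finset.mem_filter.1 (hT (hS hmem))).2

/-- Simultaneous Ramsey theorem for subsets of all cardinalities below `d`. -/
theorem exists_homogeneous_of_card_lt (K : Type) [Finite K] (d m : ℕ) :
    ∃ N : ℕ, ∀ (V : Type) [LinearOrder V] (A : Finset V) (g : Finset V → K), N ≤ A.card →
      ∃ T ⊆ A, T.card = m ∧ ∃ col : ℕ → K, ∀ S ⊆ T, S.card < d → g S = col S.card := by
  induction d with
  | zero =>
    refine ⟨m, fun V _ A g hA => ?_⟩
    obtain ⟨T, hTA, hT⟩ := Finset.exists_subset_card_eq hA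
    exact ⟨T, hTA, hT, fun _ => g ∅, fun S _ hS => absurd hS (Nat.not_lt_zero _)⟩
  | succ d ih =>
    obtain ⟨N, hN⟩ := ih
    obtain ⟨M, hM⟩ := exists_homogeneous_of_card_eq K d N
    refine ⟨M, fun V _ A g hA => ?_⟩
    obtain ⟨B, hBA, hB, col, hcol⟩ := hM V A g hA
    obtain ⟨T, hTB, hT, cols, hcols⟩ := hN V B g hB.ge
    refine ⟨T, hTB.trans hBA, hT, Function.update cols d col, fun S hS hcard => ?_⟩
    by_cases h : S.card = d
    · rw [h, Function.update_self]
      exact hcol S (hS.trans hTB) h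
    · rw [Function.update_of_ne h]
      exact hcols S hS (by omega)

open Polynomial in
/-- A linear combination of binomial coefficients involving some `m.choose k`, `k ≥ 2`,
eventually exceeds `m` in absolute value. -/
theorem eventually_lt_abs_sum_mul_choose (d : ℕ) (b : ℕ → ℝ) {k₀ : ℕ} (hk : 2 ≤ k₀)
    (hkd : k₀ < d) (hb : b k₀ ≠ 0) :
    ∀ᶠ m : ℕ in Filter.atTop, (m : ℝ) < |∑ k ∈ Finset.range d, (m.choose k : ℝ) * b k| := by
  set P : ℕ → ℝ[X] := fun d =>
    ∑ k ∈ Finset.range d, C (b k / (k.factorial : ℝ)) * descPochhammer ℝ k with hP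
  have hdeg : ∀ k, (descPochhammer ℝ k).degree = k := fun k => by
    rw [degree_eq_natDegree (monic_descPochhammer ℝ k).ne_zero, descPochhammer_natDegree]
  have hlt : ∀ d, (P d).degree < d := by
    intro d
    refine mem_degreeLT.1 (Submodule.sum_mem _ fun k hk => mem_degreeLT.2 ?_)
    rw [C_mul']
    refine (degree_smul_le _ _).trans_lt ?_
    rw [hdeg]
    exact_mod_cast Finset.mem_range.1 hk
  have hgt : ∀ d, k₀ < d → (1 : WithBot ℕ) < (P d).degree := by
    intro d
    induction d with
    | zero => intro h; omega
    | succ d ih =>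
      intro h
      have hs : P (d + 1) = P d + C (b d / (d.factorial : ℝ)) * descPochhammer ℝ d :=
        Finset.sum_range_succ _ _
      by_cases h0 : b d = 0
      · rw [hs, h0]
        simp only [zero_div, map_zero, zero_mul, add_zero]
        refine ih (lt_of_le_of_ne (by omega) ?_)
        rintro rfl
        exact hb h0
      · have hd : (C (b d / (d.factorial : ℝ)) * descPochhammer ℝ d).degree = d := by
          rw [degree_C_mul (div_ne_zero h0 (by positivity)), hdeg]
        rw [hs, degree_add_eq_right_of_degree_lt (by rw [hd]; exact hlt d), hd]
        exact_mod_cast (by omega : 1 < d)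
  have ht := (abs_div_tendsto_atTop_atTop_of_degree_gt (P d) X
    (by rw [degree_X]; exact hgt d hkd) X_ne_zero).comp
    (tendsto_natCast_atTop_atTop (R := ℝ))
  filter_upwards [ht.eventually_gt_atTop 1, Filter.eventually_gt_atTop 0] with m hm hm0
  have hm0' : (0 : ℝ) < m := by exact_mod_cast hm0
  have hev : (P d).eval (m : ℝ) = ∑ k ∈ Finset.range d, (m.choose k : ℝ) * b k := by
    rw [hP]
    simp only [eval_finsetSum, eval_mul, eval_C, descPochhammer_eval_eq_descFactorial]
    refine Finset.sum_congr rfl fun k _ => ?_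
    rw [Nat.descFactorial_eq_factorial_mul_choose]
    have : (k.factorial : ℝ) ≠ 0 := by positivity
    push_cast
    field_simp
  simp only [Function.comp, eval_X, hev, abs_div, abs_of_pos hm0'] at hm
  rwa [lt_div_iff₀ hm0', one_mul] at hm

/-- The number of surjections from `Fin d` onto `Fin k`. -/
def numSurj (d k : ℕ) : ℕ :=
  (Finset.univ.filter fun φ : Fin d → Fin k => Function.Surjective φ).card

theorem card_filter_image_eq {V : Type} [Fintype V] [DecidableEq V] (d : ℕ) (S : Finset V) :
    (Finset.univ.filter fun φ : Fin d → V => Finset.univ.image φ = S).card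
      = numSurj d S.card := by
  symm
  refine Finset.card_bij (fun φ _ j => (S.equivFin.symm (φ j) : V)) ?_ ?_ ?_
  · intro φ hφ
    have hφ' : Function.Surjective φ := (Finset.mem_filter.1 hφ).2
    refine Finset.mem_filter.2 ⟨Finset.mem_univ _, ?_⟩
    ext v
    simp only [Finset.mem_image, Finset.mem_univ, true_and]
    constructor
    · rintro ⟨j, rfl⟩
      exact (S.equivFin.symm (φ j)).2
    · intro hv
      obtain ⟨j, hj⟩ := hφ' (S.equivFin ⟨v, hv⟩)
      exact ⟨j, by rw [hj, Equiv.symm_apply_apply]⟩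
  · intro φ _ ψ _ h
    funext j
    exact S.equivFin.symm.injective (Subtype.ext (congrFun h j))
  · intro φ hφ
    have hφ' : Finset.univ.image φ = S := (Finset.mem_filter.1 hφ).2
    have hmem : ∀ j, φ j ∈ S := fun j => by
      rw [← hφ']
      exact Finset.mem_image_of_mem _ (Finset.mem_univ j)
    refine ⟨fun j => S.equivFin ⟨φ j, hmem j⟩, Finset.mem_filter.2 ⟨Finset.mem_univ _, ?_⟩, ?_⟩
    · intro i
      have h := (S.equivFin.symm i).2
      obtain ⟨j, -, hj⟩ := Finset.mem_image.1 (hφ'.ge h)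
      refine ⟨j, ?_⟩
      rw [← Equiv.eq_symm_apply]
      exact Subtype.ext hj
    · funext j
      simp

theorem numSurj_eq_zero {d k : ℕ} (h : d < k) : numSurj d k = 0 := by
  rw [numSurj, Finset.card_eq_zero, Finset.filter_eq_empty_iff]
  intro φ _ hφ
  have := Fintype.card_le_of_surjective φ hφ
  simp only [Fintype.card_fin] at this
  omega

theorem numSurj_le {d k : ℕ} (h : k ≤ d) : numSurj d k ≤ d ^ d := by
  refine (Finset.card_le_univ _).trans ?_
  rw [Fintype.card_fun, Fintype.card_fin, Fintype.card_fin]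
  exact Nat.pow_le_pow_left h d

/-- Swapping two values pairs up the surjections onto a set with at least two elements. -/
theorem two_dvd_numSurj {d k : ℕ} (hk : 2 ≤ k) : 2 ∣ numSurj d k := by
  have hs : (∑ φ ∈ Finset.univ.filter fun φ : Fin d → Fin k => Function.Surjective φ,
      (1 : ZMod 2)) = 0 := by
    let σ : Equiv.Perm (Fin k) := Equiv.swap ⟨0, by omega⟩ ⟨1, by omega⟩
    refine Finset.sum_involution (fun φ _ => σ ∘ φ) (fun _ _ => by decide) ?_ ?_ ?_
    · intro φ hφ _ h
      obtain ⟨j, hj⟩ := (Finset.mem_filter.1 hφ).2 ⟨0, by omega⟩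
      have := congrFun h j
      simp [σ, hj] at this
    · intro φ hφ
      exact Finset.mem_filter.2 ⟨Finset.mem_univ _,
        σ.surjective.comp (Finset.mem_filter.1 hφ).2⟩
    · intro φ _
      funext j
      simp [σ]
  rw [← ZMod.natCast_eq_zero_iff]
  simpa [numSurj] using hs

theorem discCol_le {V : Type} {H : Finset (Finset V)} {c : ℕ} {χ : V → Fin c} {r : ℝ}
    (hr : 0 ≤ r)
    (h : ∀ E ∈ H, ∀ i, |((E.filter fun v => χ v = i).card : ℝ) - (E.card : ℝ) / (c : ℝ)| ≤ r) :
    discCol H c χ ≤ r :=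
  Real.iSup_le (fun E => Real.iSup_le (fun hE => Real.iSup_le (h E hE) hr) hr) hr

theorem discCol_nonneg {V : Type} (H : Finset (Finset V)) (c : ℕ) (χ : V → Fin c) :
    0 ≤ discCol H c χ :=
  Real.iSup_nonneg fun _ => Real.iSup_nonneg fun _ => Real.iSup_nonneg fun _ => abs_nonneg _

theorem abs_le_discCol {V : Type} [Fintype V] {H : Finset (Finset V)} {c : ℕ} (χ : V → Fin c)
    {E : Finset V} (hE : E ∈ H) (i : Fin c) :
    |((E.filter fun v => χ v = i).card : ℝ) - (E.card : ℝ) / (c : ℝ)| ≤ discCol H c χ :=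
  (le_ciSup (f := fun i : Fin c =>
      |((E.filter fun v => χ v = i).card : ℝ) - (E.card : ℝ) / (c : ℝ)|)
    (Set.finite_range _).bddAbove i).trans <|
  (le_ciSup (f := fun _ : E ∈ H => ⨆ i : Fin c,
      |((E.filter fun v => χ v = i).card : ℝ) - (E.card : ℝ) / (c : ℝ)|)
    (Set.finite_range _).bddAbove hE).trans <|
  le_ciSup (f := fun E : Finset V => ⨆ _ : E ∈ H, ⨆ i : Fin c,
      |((E.filter fun v => χ v = i).card : ℝ) - (E.card : ℝ) / (c : ℝ)|)
    (Set.finite_range _).bddAbove E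

theorem disc_le_discCol {V : Type} [Finite V] (H : Finset (Finset V)) {c : ℕ}
    (χ : V → Fin c) : disc H c ≤ discCol H c χ :=
  ciInf_le (Set.finite_range _).bddBelow χ

theorem exists_discCol_eq_disc {V : Type} [Finite V] (H : Finset (Finset V)) {c : ℕ}
    (hc : 0 < c) : ∃ χ : V → Fin c, discCol H c χ = disc H c :=
  have : Nonempty (Fin c) := ⟨⟨0, hc⟩⟩
  exists_eq_ciInf_of_finite

/-- The imbalance of colour `i` on `E ^ d`, split according to the set of coordinates. -/
theorem card_filter_piFinset_sub {V : Type} [Fintype V] [DecidableEq V] {c d : ℕ}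
    (ψ : (Fin d → V) → Fin c) (E : Finset V) (i : Fin c) :
    (((Fintype.piFinset fun _ : Fin d => E).filter fun φ => ψ φ = i).card : ℝ)
        - ((Fintype.piFinset fun _ : Fin d => E).card : ℝ) / (c : ℝ)
      = ∑ S ∈ E.powerset,
        (((Finset.univ.filter fun φ : Fin d → V => Finset.univ.image φ = S ∧ ψ φ = i).card : ℝ)
          - (numSurj d S.card : ℝ) / (c : ℝ)) := by
  have himg : ∀ φ : Fin d → V, φ ∈ Fintype.piFinset (fun _ : Fin d => E) ↔
      Finset.univ.image φ ⊆ E := fun φ => by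
    simp [Fintype.mem_piFinset, Finset.subset_iff]
  rw [Finset.sum_sub_distrib, ← Finset.sum_div, ← Nat.cast_sum, ← Nat.cast_sum]
  congr 3
  · rw [Finset.card_eq_sum_card_fiberwise (f := fun φ => Finset.univ.image φ) (t := E.powerset)]
    · refine Finset.sum_congr rfl fun S hS => congrArg _ ?_
      ext φ
      simp only [Finset.mem_filter, himg, Finset.mem_univ, true_and]
      constructor
      · rintro ⟨⟨-, h1⟩, h2⟩
        exact ⟨h2, h1⟩
      · rintro ⟨h2, h1⟩
        exact ⟨⟨h2 ▸ Finset.mem_powerset.1 hS, h1⟩, h2⟩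
    · intro φ hφ
      exact Finset.mem_coe.2 (Finset.mem_powerset.2
        ((himg φ).1 (Finset.mem_filter.1 (Finset.mem_coe.1 hφ)).1))
  · rw [Finset.card_eq_sum_card_fiberwise (f := fun φ => Finset.univ.image φ) (t := E.powerset)]
    · refine Finset.sum_congr rfl fun S hS => ?_
      rw [← card_filter_image_eq]
      refine congrArg _ ?_
      ext φ
      simp only [Finset.mem_filter, himg, Finset.mem_univ, true_and, and_iff_right_iff_imp]
      rintro h2
      exact h2 ▸ Finset.mem_powerset.1 hS
    · intro φ hφ
      exact Finset.mem_coe.2 (Finset.mem_powerset.2 ((himg φ).1 (Finset.mem_coe.1 hφ)))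

theorem exists_balanced_coloring {α : Type} [DecidableEq α] (F : Finset α) {c : ℕ} (hc : 0 < c)
    (h : c ∣ F.card) :
    ∃ f : α → Fin c, ∀ i, (F.filter fun x => f x = i).card * c = F.card := by
  obtain ⟨t, ht⟩ := h
  let e : F ≃ Fin c × Fin t := (F.equivFin.trans (finCongr ht)).trans finProdFinEquiv.symm
  refine ⟨fun x => if hx : x ∈ F then (e ⟨x, hx⟩).1 else ⟨0, hc⟩, fun i => ?_⟩
  have : (F.filter fun x => (if hx : x ∈ F then (e ⟨x, hx⟩).1 else ⟨0, hc⟩) = i).card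
      = (Finset.univ : Finset (Fin t)).card := by
    symm
    refine Finset.card_bij (fun j _ => (e.symm (i, j) : α)) ?_ ?_ ?_
    · intro j _
      simp
    · intro j _ j' _ h
      simpa using e.symm.injective (Subtype.ext h)
    · intro x hx
      obtain ⟨hxF, hx⟩ := Finset.mem_filter.1 hx
      rw [dif_pos hxF] at hx
      refine ⟨(e ⟨x, hxF⟩).2, Finset.mem_univ _, ?_⟩
      rw [← hx, Prod.mk.eta, Equiv.symm_apply_apply]
  rw [this, Finset.card_univ, Fintype.card_fin, ht, mul_comm]

/-- If `c` divides the relevant surjection numbers, a colouring of `H` extends from the diagonal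
to `V ^ d` without any further imbalance. -/
theorem disc_symProd_le_of_dvd {c d : ℕ} (hc : 0 < c) (hd : 0 < d)
    (h : ∀ k, 2 ≤ k → c ∣ numSurj d k) {V : Type} [Fintype V] [DecidableEq V]
    (H : Finset (Finset V)) : disc (symProd H d) c ≤ disc H c := by
  obtain ⟨χ, hχ⟩ := exists_discCol_eq_disc H hc
  have hbal : ∀ S : Finset V, ∃ f : (Fin d → V) → Fin c, 2 ≤ S.card → ∀ i,
      ((Finset.univ.filter fun φ : Fin d → V => Finset.univ.image φ = S ∧ f φ = i).card : ℝ)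
        - (numSurj d S.card : ℝ) / (c : ℝ) = 0 := by
    intro S
    by_cases hS : 2 ≤ S.card
    · obtain ⟨f, hf⟩ := exists_balanced_coloring
        (Finset.univ.filter fun φ : Fin d → V => Finset.univ.image φ = S) hc
        (by rw [card_filter_image_eq]; exact h _ hS)
      refine ⟨f, fun _ i => ?_⟩
      have := hf i
      rw [card_filter_image_eq, Finset.filter_filter] at this
      rw [← this]
      have : (c : ℝ) ≠ 0 := by exact_mod_cast hc.ne'
      push_cast
      field_simp
      simp
    · exact ⟨fun _ => ⟨0, hc⟩, fun h => absurd h hS⟩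
  choose f hf using hbal
  let ψ : (Fin d → V) → Fin c := fun φ =>
    if 2 ≤ (Finset.univ.image φ).card then f (Finset.univ.image φ) φ else χ (φ ⟨0, hd⟩)
  rw [← hχ]
  refine (disc_le_discCol _ ψ).trans (discCol_le (discCol_nonneg _ _ _) ?_)
  intro E' hE' i
  obtain ⟨E, hE, rfl⟩ := Finset.mem_image.1 hE'
  refine le_of_eq_of_le (congrArg _ ?_) (abs_le_discCol χ hE i)
  have hone : numSurj d 1 = 1 := by
    rw [numSurj, Finset.card_eq_one]
    refine ⟨fun _ => 0, Finset.eq_singleton_iff_unique_mem.2 ⟨?_, fun _ _ => Subsingleton.elim _ _⟩⟩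
    exact Finset.mem_filter.2 ⟨Finset.mem_univ _, fun b => ⟨⟨0, hd⟩, Subsingleton.elim _ _⟩⟩
  have hne : ∀ φ : Fin d → V, Finset.univ.image φ ≠ ∅ := fun φ h0 =>
    Finset.notMem_empty (φ ⟨0, hd⟩) (h0 ▸ Finset.mem_image_of_mem _ (Finset.mem_univ _))
  rw [card_filter_piFinset_sub]
  have hsub : E.image (fun v => ({v} : Finset V)) ⊆ E.powerset := by
    intro S hS
    obtain ⟨v, hv, rfl⟩ := Finset.mem_image.1 hS
    exact Finset.mem_powerset.2 (Finset.singleton_subset_iff.2 hv)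
  rw [← Finset.sum_subset hsub, Finset.sum_image (fun v _ w _ h => Finset.singleton_injective h)]
  · simp only [Finset.card_singleton, hone]
    rw [Finset.sum_sub_distrib, Finset.sum_const, nsmul_eq_mul, Nat.cast_one, mul_one_div,
      Finset.card_filter, Nat.cast_sum]
    refine congrArg (· - _) (Finset.sum_congr rfl fun v _ => ?_)
    have : (Finset.univ.filter fun φ : Fin d → V => Finset.univ.image φ = {v} ∧ ψ φ = i)
        = if χ v = i then {fun _ => v} else ∅ := by
      have hconst : Finset.univ.image (fun _ : Fin d => v) = {v} :=
        Finset.image_const ⟨⟨0, hd⟩, Finset.mem_univ _⟩ v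
      have hψ : ∀ φ : Fin d → V, Finset.univ.image φ = {v} → φ = fun _ => v := fun φ h => by
        funext j
        exact Finset.mem_singleton.1 (h ▸ Finset.mem_image_of_mem φ (Finset.mem_univ j))
      have hψv : ψ (fun _ => v) = χ v := by
        simp only [ψ, hconst, Finset.card_singleton]
        simp
      ext φ
      simp only [Finset.mem_filter, Finset.mem_univ, true_and]
      constructor
      · rintro ⟨h1, h2⟩
        obtain rfl := hψ φ h1
        rw [if_pos (hψv ▸ h2)]
        exact Finset.mem_singleton_self _
      · split_ifs with hv
        · intro h1
          obtain rfl := Finset.mem_singleton.1 h1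
          exact ⟨hconst, hψv.trans hv⟩
        · intro h1
          exact absurd h1 (Finset.notMem_empty _)
    rw [this]
    split_ifs <;> simp
  · intro S hS hS1
    rcases Nat.lt_or_ge S.card 2 with hlt | hge
    · have h0 : S.card ≠ 1 := by
        intro h1
        obtain ⟨v, rfl⟩ := Finset.card_eq_one.1 h1
        exact hS1 (Finset.mem_image_of_mem _
          (Finset.singleton_subset_iff.1 (Finset.mem_powerset.1 hS)))
      obtain rfl : S = ∅ := Finset.card_eq_zero.1 (by omega)
      rw [← card_filter_image_eq, Finset.filter_eq_empty_iff.2 (fun φ _ h => hne φ h.1),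
        Finset.filter_eq_empty_iff.2 (fun φ _ h => hne φ h)]
      simp
    · rw [← hf S hge i]
      refine congrArg (fun s : Finset (Fin d → V) => (s.card : ℝ) - _) ?_
      ext φ
      simp only [Finset.mem_filter, Finset.mem_univ, true_and]
      refine and_congr_right fun h1 => ?_
      simp only [ψ, h1, if_pos hge]

/-- If `c` fails to divide one of the relevant surjection numbers, then the hypergraph of all
`m`-element subsets of a large set violates the inequality, for suitable `m`. -/
theorem exists_disc_lt_disc_symProd {c d k₀ : ℕ} (hc : 0 < c) (hk₀ : 2 ≤ k₀)
    (h : ¬ c ∣ numSurj d k₀) : ∃ (n : ℕ) (H : Finset (Finset (Fin n))),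
      disc H c < disc (symProd H d) c := by
  have hkd : k₀ ≤ d := by
    by_contra! hlt
    exact h (numSurj_eq_zero hlt ▸ dvd_zero c)
  have hc0 : (c : ℝ) ≠ 0 := by exact_mod_cast hc.ne'
  let i₀ : Fin c := ⟨0, hc⟩
  let b : (Fin (d + 1) → Fin (d ^ d + 1)) → ℕ → ℝ := fun a k =>
    ((a (Fin.ofNat (d + 1) k)).val : ℝ) - (numSurj d k : ℝ) / (c : ℝ)
  have hev : ∀ᶠ m : ℕ in Filter.atTop, ∀ a, (m : ℝ) <
      |∑ k ∈ Finset.range (d + 1), (m.choose k : ℝ) * b a k| := by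
    rw [Filter.eventually_all]
    intro a
    refine eventually_lt_abs_sum_mul_choose (d + 1) (b a) hk₀ (by omega) fun h0 => h ?_
    refine ⟨(a (Fin.ofNat (d + 1) k₀)).val, ?_⟩
    rw [sub_eq_zero, eq_div_iff hc0] at h0
    rw [mul_comm]
    exact_mod_cast h0.symm
  obtain ⟨m, hm, hdm⟩ := (hev.and (Filter.eventually_ge_atTop d)).exists
  obtain ⟨N, hN⟩ := exists_homogeneous_of_card_lt (Fin (d ^ d + 1)) (d + 1) m
  refine ⟨N, Finset.powersetCard m Finset.univ, ?_⟩
  set H : Finset (Finset (Fin N)) := Finset.powersetCard m Finset.univ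
  have hle : disc H c ≤ m := by
    refine (disc_le_discCol H fun _ => i₀).trans (discCol_le (Nat.cast_nonneg m) ?_)
    intro E hE i
    have hEm : (E.card : ℝ) = m := by exact_mod_cast (Finset.mem_powersetCard.1 hE).2
    rw [hEm]
    have h1 : ((E.filter fun _ => i₀ = i).card : ℝ) ≤ m := by
      rw [← hEm]
      exact_mod_cast Finset.card_filter_le _ _
    have h2 : (m : ℝ) / c ≤ m :=
      div_le_self (Nat.cast_nonneg m) (by exact_mod_cast hc)
    have h3 : 0 ≤ (m : ℝ) / c := by positivity
    have h4 : (0 : ℝ) ≤ ((E.filter fun _ => i₀ = i).card : ℝ) := Nat.cast_nonneg _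
    rw [abs_le]
    constructor <;> linarith
  refine hle.trans_lt ?_
  obtain ⟨ψ, hψ⟩ := exists_discCol_eq_disc (symProd H d) hc
  let cnt : Finset (Fin N) → ℕ := fun S =>
    (Finset.univ.filter fun φ : Fin d → Fin N => Finset.univ.image φ = S ∧ ψ φ = i₀).card
  have hcnt : ∀ S, cnt S ≤ numSurj d S.card := fun S => by
    rw [← card_filter_image_eq]
    exact Finset.card_le_card (Finset.monotone_filter_right _ fun _ _ h => h.1)
  obtain ⟨T, -, hT, col, hcol⟩ := hN (Fin N) Finset.univ
    (fun S => Fin.ofNat (d ^ d + 1) (cnt S)) (by simp)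
  have hTH : (Fintype.piFinset fun _ : Fin d => T) ∈ symProd H d :=
    Finset.mem_image_of_mem _ (Finset.mem_powersetCard.2 ⟨Finset.subset_univ _, hT⟩)
  have hdisc := abs_le_discCol ψ hTH i₀
  rw [hψ, card_filter_piFinset_sub] at hdisc
  refine (hm fun k => col k).trans_le (le_of_eq_of_le (congrArg _ ?_) hdisc)
  let a : Fin (d + 1) → Fin (d ^ d + 1) := fun k => col k
  let F : ℕ → ℝ := fun k => if k < d + 1 then b a k else 0
  have hterm : ∀ S ∈ T.powerset, (cnt S : ℝ) - (numSurj d S.card : ℝ) / (c : ℝ)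
      = F S.card := by
    intro S hS
    simp only [F]
    split_ifs with hlt
    · have hv := hcol S (Finset.mem_powerset.1 hS) hlt
      have hb : cnt S < d ^ d + 1 :=
        Nat.lt_succ_of_le ((hcnt S).trans (numSurj_le (by omega)))
      simp only [b, a]
      rw [Fin.val_ofNat, Nat.mod_eq_of_lt hlt, ← hv, Fin.val_ofNat, Nat.mod_eq_of_lt hb]
    · have h0 := numSurj_eq_zero (d := d) (k := S.card) (by omega)
      have h1 := hcnt S
      rw [h0] at h1 ⊢
      rw [Nat.le_zero.1 h1]
      simp
  refine Eq.trans ?_ (Finset.sum_congr rfl hterm).symm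
  rw [Finset.sum_powerset_apply_card F, hT]
  refine (Finset.sum_congr rfl fun k hk => ?_).trans
    (Finset.sum_subset (Finset.range_mono (by omega)) fun k _ hk => ?_)
  · simp only [F, if_pos (Finset.mem_range.1 hk), nsmul_eq_mul, a]
  · simp only [F, if_neg (fun h => hk (Finset.mem_range.2 h)), smul_zero]

/-- The product inequality holds for all hypergraphs precisely when `c` divides the numbers of
surjections of a `d`-element set onto sets with at least two elements. -/
theorem forall_disc_symProd_le_iff {c d : ℕ} (hc : 0 < c) (hd : 0 < d) :
    (∀ (V : Type) [Fintype V] [DecidableEq V] (H : Finset (Finset V)),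
        disc (symProd H d) c ≤ disc H c) ↔ ∀ k, 2 ≤ k → c ∣ numSurj d k := by
  constructor
  · intro h k hk
    by_contra hck
    obtain ⟨n, H, hH⟩ := exists_disc_lt_disc_symProd hc hk hck
    exact (h (Fin n) H).not_gt hH
  · intro h V _ _ H
    exact disc_symProd_le_of_dvd hc hd h H

/-- For odd `c ≥ 3` and `d ≥ 2`, `disc(Δ^d H, c) ≤ disc(H, c)` holds for all
hypergraphs `H` iff `disc(Δ^d H, 2c) ≤ disc(H, 2c)` holds for all hypergraphs `H`. -/
theorem stmt5 (c d : ℕ) (hc : 3 ≤ c) (hcodd : Odd c) (hd : 2 ≤ d) :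
    (∀ (V : Type) [Fintype V] [DecidableEq V] (H : Finset (Finset V)),
        disc (symProd H d) c ≤ disc H c) ↔
    (∀ (V : Type) [Fintype V] [DecidableEq V] (H : Finset (Finset V)),
        disc (symProd H d) (2 * c) ≤ disc H (2 * c)) := by
  rw [forall_disc_symProd_le_iff (by omega) (by omega),
    forall_disc_symProd_le_iff (by omega) (by omega)]
  refine forall₂_congr fun k hk => ⟨fun h => ?_, fun h => (dvd_mul_left c 2).trans h⟩
  exact hcodd.coprime_two_left.mul_dvd_of_dvd_of_dvd (two_dvd_numSurj hk) h
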